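/- Let H ∈ (1/2, 1) and θ < 0. There exists a constant C > 0, depending only on H and θ, such that for every positive integer n and every i ∈ {1, ..., n}, writing t_{i−1} = (i−1)/n and t_i = i/n, one has H(2H−1) ∫_{t_{i−1}}^{t_i} ∫_{t_{i−1}}^{t_i} e^{θ(2t_i − u − v)} (|u − v|^{2H−2} − (u + v)^{2H−2}) du dv ≤ C (e^{−2θ/n} − 1) n^{1−2H}. -/

import Mathlib

open Real intervalIntegral

/-- Monotonicity of the interval integral with a nonnegative integrable majorant; no integrability
of the smaller function is needed. -/
lemma intervalIntegral_le_of_le_of_nonneg {f g : ℝ → ℝ} {a b : ℝ} (hab : a ≤ b)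
    (hg : IntervalIntegrable g MeasureTheory.volume a b)
    (hg0 : ∀ x ∈ Set.Icc a b, 0 ≤ g x) (hfg : ∀ x ∈ Set.Icc a b, f x ≤ g x) :
    ∫ x in a..b, f x ≤ ∫ x in a..b, g x := by
  by_cases hf : IntervalIntegrable f MeasureTheory.volume a b
  · exact integral_mono_on hab hf hg hfg
  · rw [integral_undef hf]
    exact integral_nonneg hab hg0

lemma intervalIntegrable_abs_rpow_zero_left {r c : ℝ} (hr : -1 < r) (hc : 0 ≤ c) :
    IntervalIntegrable (fun w : ℝ => |w| ^ r) MeasureTheory.volume 0 c := by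
  refine (intervalIntegrable_rpow' hr (a := 0) (b := c)).congr fun w hw => ?_
  rw [Set.uIoc_of_le hc] at hw
  simp only [abs_of_pos hw.1]

lemma integral_abs_rpow_zero_left {r c : ℝ} (hr : -1 < r) (hc : 0 ≤ c) :
    ∫ w in (0 : ℝ)..c, |w| ^ r = c ^ (r + 1) / (r + 1) := by
  have h : ∫ w in (0 : ℝ)..c, |w| ^ r = ∫ w in (0 : ℝ)..c, w ^ r := by
    refine integral_congr fun w hw => ?_
    rw [Set.uIcc_of_le hc] at hw
    simp only [abs_of_nonneg hw.1]
  rw [h, integral_rpow (Or.inl hr), zero_rpow (by linarith), sub_zero]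

lemma intervalIntegrable_abs_rpow {r a b : ℝ} (hr : -1 < r) (ha : a ≤ 0) (hb : 0 ≤ b) :
    IntervalIntegrable (fun w : ℝ => |w| ^ r) MeasureTheory.volume a b := by
  have h := (intervalIntegrable_abs_rpow_zero_left hr (neg_nonneg.2 ha)).comp_sub_left 0
  simp only [zero_sub, abs_neg, neg_neg, neg_zero] at h
  exact h.symm.trans (intervalIntegrable_abs_rpow_zero_left hr hb)

lemma integral_abs_rpow {r a b : ℝ} (hr : -1 < r) (ha : a ≤ 0) (hb : 0 ≤ b) :
    ∫ w in a..b, |w| ^ r = (-a) ^ (r + 1) / (r + 1) + b ^ (r + 1) / (r + 1) := by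
  rw [← integral_add_adjacent_intervals (intervalIntegrable_abs_rpow hr ha le_rfl)
    (intervalIntegrable_abs_rpow hr le_rfl hb), integral_abs_rpow_zero_left hr hb,
    ← integral_abs_rpow_zero_left hr (neg_nonneg.2 ha)]
  have h := integral_comp_neg (fun w : ℝ => |w| ^ r) (a := a) (b := 0)
  simp only [abs_neg, neg_zero] at h
  rw [h]

lemma intervalIntegrable_abs_sub_rpow {r a b u : ℝ} (hr : -1 < r) (hu : u ∈ Set.Icc a b) :
    IntervalIntegrable (fun v : ℝ => |u - v| ^ r) MeasureTheory.volume a b := by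
  have h := (intervalIntegrable_abs_rpow hr (sub_nonpos.2 hu.2) (sub_nonneg.2 hu.1)).comp_sub_left u
  simp only [sub_sub_cancel] at h
  exact h.symm

lemma integral_abs_sub_rpow_le {r a b u : ℝ} (hr : -1 < r) (hu : u ∈ Set.Icc a b) :
    ∫ v in a..b, |u - v| ^ r ≤ 2 * (b - a) ^ (r + 1) / (r + 1) := by
  have hr1 : 0 < r + 1 := by linarith
  rw [integral_comp_sub_left (fun w : ℝ => |w| ^ r),
    integral_abs_rpow hr (sub_nonpos.2 hu.2) (sub_nonneg.2 hu.1), ← add_div]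
  gcongr
  have h1 : (-(u - b)) ^ (r + 1) ≤ (b - a) ^ (r + 1) :=
    rpow_le_rpow (by linarith [hu.2]) (by linarith [hu.1]) hr1.le
  have h2 : (u - a) ^ (r + 1) ≤ (b - a) ^ (r + 1) :=
    rpow_le_rpow (by linarith [hu.1]) (by linarith [hu.2]) hr1.le
  linarith

/-- For `θ ≤ 0` the exponentially weighted sub-fractional kernel has double integral over `[a, b]²`
of order `(b - a) ^ (r + 2)`. -/
lemma integral_exp_mul_subfbm_kernel_le {r θ a b : ℝ} (hr : -1 < r) (hθ : θ ≤ 0)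
    (ha : 0 ≤ a) (hab : a ≤ b) :
    ∫ u in a..b, ∫ v in a..b, exp (θ * (2 * b - u - v)) * (|u - v| ^ r - (u + v) ^ r)
      ≤ (b - a) * (2 * (b - a) ^ (r + 1) / (r + 1)) := by
  have hr1 : 0 < r + 1 := by linarith
  have hba : 0 ≤ b - a := by linarith
  have hM : 0 ≤ 2 * (b - a) ^ (r + 1) / (r + 1) := by positivity
  rw [← smul_eq_mul (b - a), ← integral_const]
  refine intervalIntegral_le_of_le_of_nonneg hab intervalIntegrable_const (fun _ _ => hM)
    fun u hu => le_trans ?_ (integral_abs_sub_rpow_le hr hu)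
  refine intervalIntegral_le_of_le_of_nonneg hab (intervalIntegrable_abs_sub_rpow hr hu)
    (fun v _ => by positivity) fun v hv => ?_
  have hexp : exp (θ * (2 * b - u - v)) ≤ 1 :=
    exp_le_one_iff.2 (mul_nonpos_of_nonpos_of_nonneg hθ (by linarith [hu.2, hv.2]))
  have hsum : 0 ≤ (u + v) ^ r := rpow_nonneg (by linarith [hu.1, hv.1]) r
  calc exp (θ * (2 * b - u - v)) * (|u - v| ^ r - (u + v) ^ r)
      ≤ exp (θ * (2 * b - u - v)) * |u - v| ^ r := by gcongr; linarith
    _ ≤ |u - v| ^ r := mul_le_of_le_one_left (by positivity) hexp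

/-- First bound of Lemma 3.3 of the paper: for `H ∈ (1/2, 1)` and `θ < 0` there is a constant
`C > 0` (depending only on `H` and `θ`) such that for all `n ≥ 1` and `1 ≤ i ≤ n`, with
`t_{i-1} = (i-1)/n` and `t_i = i/n`, the variance
`H(2H-1) ∫_{t_{i-1}}^{t_i} ∫_{t_{i-1}}^{t_i} e^{θ(2t_i - u - v)} (|u-v|^{2H-2} - (u+v)^{2H-2}) du dv`
is at most `C (e^{-2θ/n} - 1) n^{1-2H}`. -/
theorem subfbm_wiener_integral_variance_bound_small_interval
    (H θ : ℝ) (hH : H ∈ Set.Ioo (1/2 : ℝ) 1) (hθ : θ < 0) :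
    ∃ C > 0, ∀ n : ℕ, 0 < n → ∀ i : ℕ, 1 ≤ i → i ≤ n →
      H * (2*H - 1) *
        ∫ u in (((i:ℝ) - 1)/n)..((i:ℝ)/n), ∫ v in (((i:ℝ) - 1)/n)..((i:ℝ)/n),
          Real.exp (θ * (2 * ((i:ℝ)/n) - u - v)) * (|u - v| ^ (2*H - 2) - (u + v) ^ (2*H - 2))
      ≤ C * (Real.exp (-2*θ/n) - 1) * (n:ℝ) ^ (1 - 2*H) := by
  obtain ⟨hH1, -⟩ := hH
  refine ⟨H / -θ, div_pos (by linarith) (by linarith), fun n hn i hi _ => ?_⟩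
  have hn0 : (0 : ℝ) < n := by exact_mod_cast hn
  have hi1 : (1 : ℝ) ≤ i := by exact_mod_cast hi
  have hle : ((i : ℝ) - 1) / n ≤ i / n := by gcongr; linarith
  have hlen : (i : ℝ) / n - (i - 1) / n = (n : ℝ)⁻¹ := by field_simp; ring
  have hexp : -2 * θ / n ≤ exp (-2 * θ / n) - 1 := by linarith [add_one_le_exp (-2 * θ / n)]
  have hpow : ((n : ℝ)⁻¹) ^ (2 * H - 2 + 1) = (n : ℝ) ^ (1 - 2 * H) := by
    rw [inv_rpow hn0.le, ← rpow_neg hn0.le]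
    congr 1
    ring
  have hkernel := integral_exp_mul_subfbm_kernel_le (r := 2 * H - 2) (by linarith) hθ.le
    (div_nonneg (by linarith) hn0.le) hle
  rw [hlen, hpow] at hkernel
  have h2H : 0 < 2 * H - 1 := by linarith
  have hC : 0 ≤ H / -θ := div_nonneg (by linarith) (by linarith)
  refine (mul_le_mul_of_nonneg_left hkernel (mul_nonneg (by linarith) h2H.le)).trans ?_
  calc H * (2 * H - 1) * ((n : ℝ)⁻¹ * (2 * (n : ℝ) ^ (1 - 2 * H) / (2 * H - 2 + 1)))
      = H / -θ * (-2 * θ / n) * (n : ℝ) ^ (1 - 2 * H) := by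
        rw [show 2 * H - 2 + 1 = 2 * H - 1 by ring]
        have hθ0 := hθ.ne
        have hH0 : H * 2 - 1 ≠ 0 := by rw [mul_comm]; exact h2H.ne'
        field_simp
    _ ≤ H / -θ * (exp (-2 * θ / n) - 1) * (n : ℝ) ^ (1 - 2 * H) := by gcongr
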